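/- arXiv:1307.5923 — 2 statements merged into one kernel-verified Lean document; each statement's English description precedes it below -/
import Mathlib

section
/- For every integer n ≥ 0, all integers j, k ≥ 0 with j + k ≤ n, and every (x,y,z) ∈ B₃: z·Q_n^{j,k} = e₁^{[n]}_{j,k}·Q_{n+1}^{j,k−1} + e₂^{[n]}_{j,k}·Q_{n+1}^{j+2,k−1} + e₃^{[n]}_{j,k}·Q_{n+1}^{j,k+1} + e₄^{[n]}_{j,k}·Q_{n+1}^{j−2,k+1} + e₄^{[n−1]}_{j+2,k−1}·Q_{n−1}^{j+2,k−1} + e₃^{[n−1]}_{j,k−1}·Q_{n−1}^{j,k−1} + e₂^{[n−1]}_{j−2,k+1}·Q_{n−1}^{j−2,k+1} + e₁^{[n−1]}_{j,k+1}·Q_{n−1}^{j,k+1}, where e₁^{[m]}_{j,k} = −(k/8)·√((j+2k+1)(j+2k)(m+2−j−k)(m+1−j−k)/((k+1/2)(k−1/2)(j+k+1)(j+k)(m+3/2)(m+5/2))), e₂^{[m]}_{j,k} = −(k/8)·√((j+2)(j+1)(j+k+m+4)(j+k+m+3)/((k+1/2)(k−1/2)(j+k+1)(j+k+2)(m+3/2)(m+5/2))),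 e₃^{[m]}_{j,k} = ((k+1)/8)·√((j+2k+3)(j+2k+2)(j+k+m+4)(j+k+m+3)/((k+1/2)(k+3/2)(j+k+1)(j+k+2)(m+3/2)(m+5/2))), e₄^{[m]}_{j,k} = ((k+1)/8)·√((m+2−j−k)(m+1−j−k)·j·(j−1)/((k+1/2)(k+3/2)(j+k)(j+k+1)(m+3/2)(m+5/2))), with the convention that any term Q_m^{j′,k′} with j′ < 0, k′ < 0, or j′ + k′ > m is taken to be 0. -/
open MeasureTheory Real Filter

/-- The Gegenbauer polynomials `C_n^λ`, defined by their triple recursion. -/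
noncomputable def gegenbauer (lam : ℝ) : ℕ → ℝ → ℝ
  | 0, _ => 1
  | 1, t => 2 * lam * t
  | (n + 2), t =>
      (2 * (((n : ℝ) + 1) + lam) / ((n : ℝ) + 2)) * t * gegenbauer lam (n + 1) t
        - ((((n : ℝ) + 1) + 2 * lam - 1) / ((n : ℝ) + 2)) * gegenbauer lam n t

/-- The open unit ball in `ℝ³`. -/
def unitBall3 : Set (ℝ × ℝ × ℝ) := {p | p.1 ^ 2 + p.2.1 ^ 2 + p.2.2 ^ 2 < 1}

/-- `(N_m^{[μ]})²`, the squared weighted `L²`-norm of the Gegenbauer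
polynomial `C_m^μ`. -/
noncomputable def Nsq (mu : ℝ) (m : ℕ) : ℝ :=
  π * Real.Gamma (2 * mu + m) /
    ((2 : ℝ) ^ (2 * mu - 1) * (Nat.factorial m : ℝ) * (mu + m) * Real.Gamma mu ^ 2)

/-- The normalization constant `h_{j,k,n}`. -/
noncomputable def h3 (j k n : ℕ) : ℝ :=
  Real.sqrt (Nsq (1 / 2) k * Nsq ((k : ℝ) + 1) j *
    Nsq ((j : ℝ) + (k : ℝ) + 3 / 2) (n - j - k))

/-- The orthonormal polynomial basis `Q_n^{j,k}` on the unit ball. -/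
noncomputable def Q3 (n j k : ℕ) (x y z : ℝ) : ℝ :=
  (1 / h3 j k n) * gegenbauer ((j : ℝ) + (k : ℝ) + 3 / 2) (n - j - k) x *
    (1 - x ^ 2) ^ ((j : ℝ) / 2) * gegenbauer ((k : ℝ) + 1) j (y / Real.sqrt (1 - x ^ 2)) *
    (1 - x ^ 2 - y ^ 2) ^ ((k : ℝ) / 2) *
    gegenbauer (1 / 2) k (z / Real.sqrt (1 - x ^ 2 - y ^ 2))

/-- `Q_m^{j,k}` extended by the convention that it vanishes when `j < 0`,
`k < 0`, or `j + k > m`. -/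
noncomputable def Q3ext (m j k : ℤ) (x y z : ℝ) : ℝ :=
  if 0 ≤ j ∧ 0 ≤ k ∧ j + k ≤ m then Q3 m.toNat j.toNat k.toNat x y z else 0

/-- The recursion coefficient `e₁^{[m]}_{j,k}`. -/
noncomputable def e1 (j k m : ℤ) : ℝ :=
  -((k : ℝ) / 8) * Real.sqrt (((j : ℝ) + 2 * k + 1) * ((j : ℝ) + 2 * k) *
      ((m : ℝ) + 2 - j - k) * ((m : ℝ) + 1 - j - k) /
    (((k : ℝ) + 1 / 2) * ((k : ℝ) - 1 / 2) * ((j : ℝ) + k + 1) * ((j : ℝ) + k) *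
      ((m : ℝ) + 3 / 2) * ((m : ℝ) + 5 / 2)))

/-- The recursion coefficient `e₂^{[m]}_{j,k}`. -/
noncomputable def e2 (j k m : ℤ) : ℝ :=
  -((k : ℝ) / 8) * Real.sqrt (((j : ℝ) + 2) * ((j : ℝ) + 1) *
      ((j : ℝ) + k + m + 4) * ((j : ℝ) + k + m + 3) /
    (((k : ℝ) + 1 / 2) * ((k : ℝ) - 1 / 2) * ((j : ℝ) + k + 1) * ((j : ℝ) + k + 2) *
      ((m : ℝ) + 3 / 2) * ((m : ℝ) + 5 / 2)))

/-- The recursion coefficient `e₃^{[m]}_{j,k}`. -/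
noncomputable def e3 (j k m : ℤ) : ℝ :=
  (((k : ℝ) + 1) / 8) * Real.sqrt (((j : ℝ) + 2 * k + 3) * ((j : ℝ) + 2 * k + 2) *
      ((j : ℝ) + k + m + 4) * ((j : ℝ) + k + m + 3) /
    (((k : ℝ) + 1 / 2) * ((k : ℝ) + 3 / 2) * ((j : ℝ) + k + 1) * ((j : ℝ) + k + 2) *
      ((m : ℝ) + 3 / 2) * ((m : ℝ) + 5 / 2)))

/-- The recursion coefficient `e₄^{[m]}_{j,k}`. -/
noncomputable def e4 (j k m : ℤ) : ℝ :=
  (((k : ℝ) + 1) / 8) * Real.sqrt (((m : ℝ) + 2 - j - k) * ((m : ℝ) + 1 - j - k) *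
      (j : ℝ) * ((j : ℝ) - 1) /
    (((k : ℝ) + 1 / 2) * ((k : ℝ) + 3 / 2) * ((j : ℝ) + k) * ((j : ℝ) + k + 1) *
      ((m : ℝ) + 3 / 2) * ((m : ℝ) + 5 / 2)))

theorem gegenbauer_zero (lam t : ℝ) : gegenbauer lam 0 t = 1 := by rw [gegenbauer]

theorem gegenbauer_one (lam t : ℝ) : gegenbauer lam 1 t = 2 * lam * t := by rw [gegenbauer]

theorem gegenbauer_add_two (lam : ℝ) (n : ℕ) (t : ℝ) :
    gegenbauer lam (n + 2) t =
      (2 * (((n : ℝ) + 1) + lam) / ((n : ℝ) + 2)) * t * gegenbauer lam (n + 1) t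
        - ((((n : ℝ) + 1) + 2 * lam - 1) / ((n : ℝ) + 2)) * gegenbauer lam n t := by
  rw [gegenbauer]

/-- Connection formula raising the parameter. -/
theorem gegenbauer_raise {lam : ℝ} (hlam : 0 < lam) (t : ℝ) (n : ℕ) :
    gegenbauer lam (n + 2) t = lam / (n + 2 + lam) *
      (gegenbauer (lam + 1) (n + 2) t - gegenbauer (lam + 1) n t) := by
  induction n using Nat.twoStepInduction with
  | zero =>
    simp only [gegenbauer_add_two, gegenbauer_zero, gegenbauer_one, zero_add]
    push_cast
    field_simp
    ring
  | one =>
    have h3 : ∀ l, gegenbauer l 3 t = _ := fun l => gegenbauer_add_two l 1 t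
    have h2 : ∀ l, gegenbauer l 2 t = _ := fun l => gegenbauer_add_two l 0 t
    simp only [Nat.reduceAdd, h3, h2, gegenbauer_zero, gegenbauer_one, zero_add]
    push_cast
    field_simp
    ring
  | more n h0 h1 =>
    rw [gegenbauer_add_two lam (n + 2) t, h1, h0, gegenbauer_add_two (lam + 1) (n + 2) t,
      gegenbauer_add_two (lam + 1) (n + 1) t, gegenbauer_add_two (lam + 1) n t]
    push_cast
    have hn4 : (n : ℝ) + 2 + 2 + lam ≠ 0 := by positivity
    have hn3 : (n : ℝ) + 1 + 2 + lam ≠ 0 := by positivity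
    generalize gegenbauer (lam + 1) (n + 1) t = D1 at *
    generalize gegenbauer (lam + 1) n t = D0 at *
    field_simp
    ring

/-- Connection formula lowering the parameter at the cost of the weight `1 - t²`. -/
theorem gegenbauer_lower {lam : ℝ} (hlam : 0 < lam) (t : ℝ) (n : ℕ) :
    (1 - t ^ 2) * gegenbauer (lam + 1) n t =
      (((n : ℝ) + 2 * lam) * (n + 2 * lam + 1) * gegenbauer lam n t -
        ((n : ℝ) + 1) * (n + 2) * gegenbauer lam (n + 2) t) / (4 * lam * (n + lam + 1)) := by
  induction n using Nat.twoStepInduction with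
  | zero =>
    simp only [gegenbauer_add_two, gegenbauer_zero, gegenbauer_one, zero_add]
    push_cast
    field_simp
    ring
  | one =>
    have h3 : ∀ l, gegenbauer l 3 t = _ := fun l => gegenbauer_add_two l 1 t
    have h2 : ∀ l, gegenbauer l 2 t = _ := fun l => gegenbauer_add_two l 0 t
    simp only [Nat.reduceAdd, h3, h2, gegenbauer_zero, gegenbauer_one, zero_add]
    push_cast
    field_simp
    ring
  | more n h0 h1 =>
    have h : (1 - t ^ 2) * gegenbauer (lam + 1) (n + 2) t =
        (2 * (((n : ℝ) + 1) + (lam + 1)) / ((n : ℝ) + 2)) * t *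
          ((1 - t ^ 2) * gegenbauer (lam + 1) (n + 1) t)
        - ((((n : ℝ) + 1) + 2 * (lam + 1) - 1) / ((n : ℝ) + 2)) *
          ((1 - t ^ 2) * gegenbauer (lam + 1) n t) := by
      rw [gegenbauer_add_two]
      ring
    rw [h, h1, h0, gegenbauer_add_two lam (n + 2) t, gegenbauer_add_two lam (n + 1) t,
      gegenbauer_add_two lam n t]
    push_cast
    generalize gegenbauer lam (n + 1) t = D1 at *
    generalize gegenbauer lam n t = D0 at *
    field_simp
    ring

theorem gegenbauer_half_mul (k : ℕ) (t : ℝ) :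
    t * gegenbauer (1 / 2) (k + 1) t = ((k + 2) * gegenbauer (1 / 2) (k + 2) t +
      (k + 1) * gegenbauer (1 / 2) k t) / (2 * k + 3) := by
  rw [gegenbauer_add_two]
  field_simp
  ring

theorem Nsq_pos {mu : ℝ} (hmu : 0 < mu) (m : ℕ) : 0 < Nsq mu m := by
  have h1 : 0 < Real.Gamma (2 * mu + m) := Real.Gamma_pos_of_pos (by positivity)
  have h2 : 0 < Real.Gamma mu := Real.Gamma_pos_of_pos hmu
  unfold Nsq
  positivity

theorem Nsq_half_succ (k : ℕ) :
    Nsq (1 / 2) (k + 1) = Nsq (1 / 2) k * ((k + 1 / 2) / (k + 3 / 2)) := by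
  have h2 : 0 < Real.Gamma (1 / 2) := Real.Gamma_pos_of_pos (by norm_num)
  have h1 : Real.Gamma (2 * (1 / 2) + ((k + 1 : ℕ) : ℝ)) =
      (k + 1) * Real.Gamma (2 * (1 / 2) + k) := by
    rw [show 2 * (1 / 2) + ((k + 1 : ℕ) : ℝ) = (k + 1) + 1 by push_cast; ring,
      Real.Gamma_add_one (by positivity)]
    congr 2
    ring
  unfold Nsq
  rw [h1, Nat.factorial_succ]
  push_cast
  field_simp
  ring

theorem Gamma_add_two {s : ℝ} (hs : 0 < s) :
    Real.Gamma (s + 2) = (s + 1) * s * Real.Gamma s := by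
  rw [show s + 2 = s + 1 + 1 by ring, Real.Gamma_add_one (by positivity),
    Real.Gamma_add_one hs.ne', mul_assoc]

theorem Nsq_add_one {mu nu : ℝ} (hmu : 0 < mu) (hnu : nu = mu + 1) (m : ℕ) :
    Nsq nu m = Nsq mu m *
      ((2 * mu + m + 1) * (2 * mu + m) * (mu + m) / (4 * mu ^ 2 * (mu + m + 1))) := by
  subst hnu
  have h2 : 0 < Real.Gamma mu := Real.Gamma_pos_of_pos hmu
  have h3 : (2 : ℝ) ^ (2 * (mu + 1) - 1) = 4 * 2 ^ (2 * mu - 1) := by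
    rw [show 2 * (mu + 1) - 1 = (2 * mu - 1) + (2 : ℕ) by push_cast; ring,
      Real.rpow_add_natCast (by norm_num)]
    ring
  unfold Nsq
  rw [show 2 * (mu + 1) + m = (2 * mu + m) + 2 by ring, Gamma_add_two (by positivity),
    Real.Gamma_add_one hmu.ne', h3]
  field_simp
  ring

theorem Nsq_add_one_sub_two {mu nu : ℝ} (hmu : 0 < mu) (hnu : nu = mu + 1) (m : ℕ) :
    Nsq nu m = Nsq mu (m + 2) *
      (((m : ℝ) + 2) * (m + 1) * (mu + m + 2) / (4 * mu ^ 2 * (mu + m + 1))) := by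
  rw [Nsq_add_one hmu hnu]
  have h2 : 0 < Real.Gamma mu := Real.Gamma_pos_of_pos hmu
  unfold Nsq
  rw [show 2 * mu + ((m + 2 : ℕ) : ℝ) = (2 * mu + m) + 2 by push_cast; ring,
    Gamma_add_two (by positivity), Nat.factorial_succ, Nat.factorial_succ]
  push_cast
  field_simp
  ring

theorem gegenbauer_raise_of_lt_two {lam : ℝ} (hlam : 0 < lam) (t : ℝ) {n : ℕ} (hn : n < 2) :
    gegenbauer lam n t = lam / (n + lam) * gegenbauer (lam + 1) n t := by
  interval_cases n
  · simp [gegenbauer_zero, hlam.ne']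
  · have h : 1 + lam ≠ 0 := by positivity
    simp only [gegenbauer_one, Nat.cast_one]
    field_simp
    ring

/-- The squared norm of the basis element of degree `m + j + k`. -/
noncomputable def normSq3 (m j k : ℕ) : ℝ :=
  Nsq (1 / 2) k * Nsq ((k : ℝ) + 1) j * Nsq ((j : ℝ) + (k : ℝ) + 3 / 2) m

theorem normSq3_pos (m j k : ℕ) : 0 < normSq3 m j k :=
  mul_pos (mul_pos (Nsq_pos (by norm_num) k) (Nsq_pos (by positivity) j))
    (Nsq_pos (by positivity) m)

theorem normSq3_succ (m j k : ℕ) :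
    normSq3 m j (k + 1) = normSq3 m j k * (((k + 1 / 2) / (k + 3 / 2)) *
      ((j + 2 * k + 3) * (j + 2 * k + 2) / (4 * (k + 1) * (j + k + 2)) * ((j + k + 1) / (k + 1))) *
      ((m + 2 * j + 2 * k + 4) * (m + 2 * j + 2 * k + 3) * (m + j + k + 3 / 2) /
        (4 * (j + k + 3 / 2) ^ 2 * (m + j + k + 5 / 2)))) := by
  unfold normSq3
  rw [Nsq_half_succ,
    Nsq_add_one (mu := (k : ℝ) + 1) (by positivity) (by push_cast; ring) j,
    Nsq_add_one (mu := (j : ℝ) + k + 3 / 2) (by positivity) (by push_cast; ring) m]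
  field_simp
  ring

theorem normSq3_succ_sub_two_left (m j k : ℕ) :
    normSq3 m j (k + 1) = normSq3 (m + 2) j k * (((k + 1 / 2) / (k + 3 / 2)) *
      ((j + 2 * k + 3) * (j + 2 * k + 2) / (4 * (k + 1) * (j + k + 2)) * ((j + k + 1) / (k + 1))) *
      ((m + 2) * (m + 1) * (m + j + k + 7 / 2) /
        (4 * (j + k + 3 / 2) ^ 2 * (m + j + k + 5 / 2)))) := by
  unfold normSq3
  rw [Nsq_half_succ,
    Nsq_add_one (mu := (k : ℝ) + 1) (by positivity) (by push_cast; ring) j,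
    Nsq_add_one_sub_two (mu := (j : ℝ) + k + 3 / 2) (by positivity) (by push_cast; ring) m]
  field_simp
  ring

theorem normSq3_succ_shift (m j k : ℕ) :
    normSq3 m (j + 2) k = normSq3 (m + 2) j (k + 1) * (((k + 3 / 2) / (k + 1 / 2)) *
      ((4 * (k + 1) ^ 2 * (j + k + 2)) / ((j + 2) * (j + 1) * (j + k + 3))) *
      ((m + 2) * (m + 1) * (m + j + k + 9 / 2) /
        (4 * (j + k + 5 / 2) ^ 2 * (m + j + k + 7 / 2)))) := by
  unfold normSq3
  rw [Nsq_half_succ,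
    Nsq_add_one_sub_two (mu := (k : ℝ) + 1) (by positivity) (by push_cast; ring) j,
    Nsq_add_one_sub_two (mu := (j : ℝ) + (k + 1 : ℕ) + 3 / 2) (by positivity)
      (by push_cast; ring) m]
  push_cast
  field_simp
  ring

theorem normSq3_succ_sub_two (m j k : ℕ) :
    normSq3 m (j + 2) k = normSq3 m j (k + 1) * (((k + 3 / 2) / (k + 1 / 2)) *
      ((4 * (k + 1) ^ 2 * (j + k + 2)) / ((j + 2) * (j + 1) * (j + k + 3))) *
      ((m + 2 * j + 2 * k + 6) * (m + 2 * j + 2 * k + 5) * (m + j + k + 5 / 2) /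
        (4 * (j + k + 5 / 2) ^ 2 * (m + j + k + 7 / 2)))) := by
  unfold normSq3
  rw [Nsq_half_succ,
    Nsq_add_one_sub_two (mu := (k : ℝ) + 1) (by positivity) (by push_cast; ring) j,
    Nsq_add_one (mu := (j : ℝ) + (k + 1 : ℕ) + 3 / 2) (by positivity)
      (by push_cast; ring) m]
  push_cast
  field_simp
  ring

theorem mul_sqrt_div_sqrt {H H' r s d R : ℝ} (hH : 0 < H) (hH' : 0 < H') (hd : 0 ≤ d)
    (hr : H' = H * r) (h : R = d ^ 2 * r) : s * √R / √H' = s * d / √H := by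
  have hr0 : 0 < r := by
    by_contra hcon
    exact absurd hH' (not_lt.2 (hr ▸ mul_nonpos_of_nonneg_of_nonpos hH.le (not_lt.1 hcon)))
  rw [h, hr, Real.sqrt_mul (sq_nonneg d), Real.sqrt_sq hd, Real.sqrt_mul hH.le]
  have := Real.sqrt_pos.2 hr0
  have := Real.sqrt_pos.2 hH
  field_simp

theorem mul_sqrt_div_sqrt' {H H' r s d R : ℝ} (hH : 0 < H) (hH' : 0 < H') (hd : 0 ≤ d)
    (hr : H = H' * r) (h : R * r = d ^ 2) : s * √R / √H' = s * d / √H := by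
  have hr0 : 0 < r := by
    by_contra hcon
    exact absurd hH (not_lt.2 (hr ▸ mul_nonpos_of_nonneg_of_nonpos hH'.le (not_lt.1 hcon)))
  refine mul_sqrt_div_sqrt hH hH' hd (r := r⁻¹) ?_ ?_
  · rw [hr]
    field_simp
  · rw [← h]
    field_simp

theorem e3_div_sqrt_normSq3_up (m j k : ℕ) :
    e3 j k (m + j + k) / √(normSq3 m j (k + 1)) =
      ((k : ℝ) + 1) ^ 2 / ((2 * k + 1) * (j + k + 1)) *
        ((j + k + 3 / 2) / (m + (j + k + 3 / 2))) / √(normSq3 m j k) := by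
  unfold e3
  rw [mul_sqrt_div_sqrt (normSq3_pos m j k) (normSq3_pos _ _ _)
    (d := 8 * ((k + 1) / ((2 * k + 1) * (j + k + 1)) *
        ((j + k + 3 / 2) / (m + (j + k + 3 / 2))))) (by positivity) (normSq3_succ m j k)]
  · push_cast
    field_simp
  · push_cast
    field_simp
    ring

theorem e1_div_sqrt_normSq3_up (m j k : ℕ) :
    e1 j (k + 1) (m + 2 + j + k - 1) / √(normSq3 m j (k + 1)) =
      -(((k : ℝ) + 1) ^ 2 / ((2 * k + 1) * (j + k + 1)) *
        ((j + k + 3 / 2) / (m + 2 + (j + k + 3 / 2)))) / √(normSq3 (m + 2) j k) := by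
  unfold e1
  rw [mul_sqrt_div_sqrt (normSq3_pos (m + 2) j k) (normSq3_pos _ _ _)
    (d := 8 * ((k + 1) / ((2 * k + 1) * (j + k + 1)) *
        ((j + k + 3 / 2) / (m + 2 + (j + k + 3 / 2))))) (by positivity)
        (normSq3_succ_sub_two_left m j k)]
  · push_cast
    field_simp
  · push_cast
    rw [show (k : ℝ) + 1 - 1 / 2 = k + 1 / 2 by ring,
      show (m : ℝ) + 2 + j + k - 1 + 2 - j - (k + 1) = m + 2 by ring,
      show (m : ℝ) + 2 + j + k - 1 + 1 - j - (k + 1) = m + 1 by ring,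
      show (m : ℝ) + 2 + j + k - 1 + 3 / 2 = m + j + k + 5 / 2 by ring,
      show (m : ℝ) + 2 + j + k - 1 + 5 / 2 = m + j + k + 7 / 2 by ring]
    field_simp
    ring

theorem e4_div_sqrt_normSq3_up (m j k : ℕ) :
    e4 (j + 2) k (m + (j + 2) + k) / √(normSq3 (m + 2) j (k + 1)) =
      ((k : ℝ) + 1) ^ 2 / ((2 * k + 1) * (j + k + 3)) *
        ((m + 1) * (m + 2) / (4 * (j + k + 5 / 2) * (m + (j + k + 5 / 2) + 1))) /
          √(normSq3 m (j + 2) k) := by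
  unfold e4
  rw [mul_sqrt_div_sqrt' (normSq3_pos m (j + 2) k) (normSq3_pos _ _ _)
    (d := 8 * ((k + 1) / ((2 * k + 1) * (j + k + 3)) *
        ((m + 1) * (m + 2) / (4 * (j + k + 5 / 2) * (m + (j + k + 5 / 2) + 1)))))
        (by positivity) (normSq3_succ_shift m j k)]
  · push_cast
    field_simp
  · push_cast
    rw [show (m : ℝ) + (j + 2) + k + 2 - (j + 2) - k = m + 2 by ring,
      show (m : ℝ) + (j + 2) + k + 1 - (j + 2) - k = m + 1 by ring,
      show (j : ℝ) + 2 - 1 = j + 1 by ring]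
    field_simp
    ring

theorem e2_div_sqrt_normSq3_up (m j k : ℕ) :
    e2 j (k + 1) (m + (j + 2) + k - 1) / √(normSq3 m j (k + 1)) =
      -(((k : ℝ) + 1) ^ 2 / ((2 * k + 1) * (j + k + 3)) *
        ((m + 2 * (j + k + 5 / 2)) * (m + 2 * (j + k + 5 / 2) + 1) /
          (4 * (j + k + 5 / 2) * (m + (j + k + 5 / 2) + 1)))) /
          √(normSq3 m (j + 2) k) := by
  unfold e2
  rw [mul_sqrt_div_sqrt' (normSq3_pos m (j + 2) k) (normSq3_pos _ _ _)
    (d := 8 * ((k + 1) / ((2 * k + 1) * (j + k + 3)) *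
        ((m + 2 * (j + k + 5 / 2)) * (m + 2 * (j + k + 5 / 2) + 1) /
          (4 * (j + k + 5 / 2) * (m + (j + k + 5 / 2) + 1)))))
        (by positivity) (normSq3_succ_sub_two m j k)]
  · push_cast
    field_simp
  · push_cast
    rw [show (k : ℝ) + 1 - 1 / 2 = k + 1 / 2 by ring,
      show (j : ℝ) + (k + 1) + (m + (j + 2) + k - 1) + 4 = m + 2 * j + 2 * k + 6 by ring,
      show (j : ℝ) + (k + 1) + (m + (j + 2) + k - 1) + 3 = m + 2 * j + 2 * k + 5 by ring,
      show (m : ℝ) + (j + 2) + k - 1 + 3 / 2 = m + j + k + 5 / 2 by ring,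
      show (m : ℝ) + (j + 2) + k - 1 + 5 / 2 = m + j + k + 7 / 2 by ring]
    field_simp
    ring

theorem e1_div_sqrt_normSq3_down (m j k : ℕ) :
    e1 j (k + 1) (m + j + (k + 1)) / √(normSq3 (m + 2) j k) =
      -(((j : ℝ) + 2 * k + 2) * (j + 2 * k + 3) / (4 * (2 * k + 3) * (j + k + 2)) *
        ((m + 1) * (m + 2) / (4 * (j + k + 3 / 2) * (m + (j + k + 3 / 2) + 1)))) /
          √(normSq3 m j (k + 1)) := by
  unfold e1
  rw [mul_sqrt_div_sqrt' (normSq3_pos m j (k + 1)) (normSq3_pos _ _ _)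
    (d := 8 / (k + 1) * ((j + 2 * k + 2) * (j + 2 * k + 3) / (4 * (2 * k + 3) * (j + k + 2)) *
        ((m + 1) * (m + 2) / (4 * (j + k + 3 / 2) * (m + (j + k + 3 / 2) + 1)))))
        (by positivity) (normSq3_succ_sub_two_left m j k)]
  · push_cast
    field_simp
  · push_cast
    rw [show (k : ℝ) + 1 - 1 / 2 = k + 1 / 2 by ring,
      show (m : ℝ) + j + (k + 1) + 2 - j - (k + 1) = m + 2 by ring,
      show (m : ℝ) + j + (k + 1) + 1 - j - (k + 1) = m + 1 by ring]
    field_simp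
    ring

theorem e3_div_sqrt_normSq3_down (m j k : ℕ) :
    e3 j k (m + j + (k + 1) - 1) / √(normSq3 m j k) =
      ((j : ℝ) + 2 * k + 2) * (j + 2 * k + 3) / (4 * (2 * k + 3) * (j + k + 2)) *
        ((m + 2 * (j + k + 3 / 2)) * (m + 2 * (j + k + 3 / 2) + 1) /
          (4 * (j + k + 3 / 2) * (m + (j + k + 3 / 2) + 1))) /
          √(normSq3 m j (k + 1)) := by
  unfold e3
  rw [mul_sqrt_div_sqrt' (normSq3_pos m j (k + 1)) (normSq3_pos _ _ _)
    (d := 8 / (k + 1) * ((j + 2 * k + 2) * (j + 2 * k + 3) / (4 * (2 * k + 3) * (j + k + 2)) *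
        ((m + 2 * (j + k + 3 / 2)) * (m + 2 * (j + k + 3 / 2) + 1) /
          (4 * (j + k + 3 / 2) * (m + (j + k + 3 / 2) + 1)))))
        (by positivity) (normSq3_succ m j k)]
  · push_cast
    field_simp
  · push_cast
    rw [show (j : ℝ) + k + (m + j + (k + 1) - 1) + 4 = m + 2 * j + 2 * k + 4 by ring,
      show (j : ℝ) + k + (m + j + (k + 1) - 1) + 3 = m + 2 * j + 2 * k + 3 by ring,
      show (m : ℝ) + j + (k + 1) - 1 + 3 / 2 = m + j + k + 3 / 2 by ring,
      show (m : ℝ) + j + (k + 1) - 1 + 5 / 2 = m + j + k + 5 / 2 by ring]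
    field_simp
    ring

theorem e2_div_sqrt_normSq3_down (m j k : ℕ) :
    e2 j (k + 1) (m + j + (k + 1)) / √(normSq3 m (j + 2) k) =
      -(((j : ℝ) + 1) * (j + 2) / (4 * (2 * k + 3) * (j + k + 2)) *
        ((j + k + 5 / 2) / (m + (j + k + 5 / 2)))) / √(normSq3 m j (k + 1)) := by
  unfold e2
  rw [mul_sqrt_div_sqrt (normSq3_pos m j (k + 1)) (normSq3_pos _ _ _)
    (d := 8 / (k + 1) * ((j + 1) * (j + 2) / (4 * (2 * k + 3) * (j + k + 2)) *
        ((j + k + 5 / 2) / (m + (j + k + 5 / 2)))))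
        (by positivity) (normSq3_succ_sub_two m j k)]
  · push_cast
    field_simp
  · push_cast
    rw [show (k : ℝ) + 1 - 1 / 2 = k + 1 / 2 by ring]
    field_simp
    ring

theorem e4_div_sqrt_normSq3_down (m j k : ℕ) :
    e4 (j + 2) k (m + 2 + j + (k + 1) - 1) / √(normSq3 m (j + 2) k) =
      ((j : ℝ) + 1) * (j + 2) / (4 * (2 * k + 3) * (j + k + 2)) *
        ((j + k + 5 / 2) / (m + 2 + (j + k + 5 / 2))) / √(normSq3 (m + 2) j (k + 1)) := by
  unfold e4
  rw [mul_sqrt_div_sqrt (normSq3_pos (m + 2) j (k + 1)) (normSq3_pos _ _ _)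
    (d := 8 / (k + 1) * ((j + 1) * (j + 2) / (4 * (2 * k + 3) * (j + k + 2)) *
        ((j + k + 5 / 2) / (m + 2 + (j + k + 5 / 2)))))
        (by positivity) (normSq3_succ_shift m j k)]
  · push_cast
    field_simp
  · push_cast
    rw [show (m : ℝ) + 2 + j + (k + 1) - 1 + 2 - (j + 2) - k = m + 2 by ring,
      show (m : ℝ) + 2 + j + (k + 1) - 1 + 1 - (j + 2) - k = m + 1 by ring,
      show (m : ℝ) + 2 + j + (k + 1) - 1 + 3 / 2 = m + j + k + 7 / 2 by ring,
      show (m : ℝ) + 2 + j + (k + 1) - 1 + 5 / 2 = m + j + k + 9 / 2 by ring,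
      show (j : ℝ) + 2 - 1 = j + 1 by ring]
    field_simp
    ring

/-- The factor of the basis element not depending on the degree of the polynomial in `x`. -/
noncomputable def ballTail (x y z : ℝ) (j k : ℕ) : ℝ :=
  √(1 - x ^ 2) ^ j * gegenbauer ((k : ℝ) + 1) j (y / √(1 - x ^ 2)) *
    (√(1 - x ^ 2 - y ^ 2) ^ k * gegenbauer (1 / 2) k (z / √(1 - x ^ 2 - y ^ 2)))

theorem rpow_half_natCast {a : ℝ} (ha : 0 ≤ a) (j : ℕ) : a ^ ((j : ℝ) / 2) = √a ^ j := by
  rw [Real.sqrt_eq_rpow, ← Real.rpow_natCast, ← Real.rpow_mul ha]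
  congr 1
  ring

theorem Q3_eq {x y : ℝ} (hxy : 0 < 1 - x ^ 2 - y ^ 2) (z : ℝ) (m j k : ℕ) :
    Q3 (m + j + k) j k x y z =
      gegenbauer ((j : ℝ) + k + 3 / 2) m x * ballTail x y z j k / √(normSq3 m j k) := by
  have hx : 0 ≤ 1 - x ^ 2 := by nlinarith [sq_nonneg y]
  unfold Q3 h3 ballTail normSq3
  rw [show m + j + k - j - k = m by omega, rpow_half_natCast hx, rpow_half_natCast hxy.le]
  ring

theorem Q3ext_eq {x y : ℝ} (hxy : 0 < 1 - x ^ 2 - y ^ 2) (z : ℝ) {m j k : ℕ} {M J K : ℤ}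
    (hM : M = m + j + k) (hJ : J = j) (hK : K = k) :
    Q3ext M J K x y z =
      gegenbauer ((j : ℝ) + k + 3 / 2) m x * ballTail x y z j k / √(normSq3 m j k) := by
  rw [← Q3_eq hxy, Q3ext, if_pos (by omega)]
  congr <;> omega

theorem Q3ext_eq_zero (x y z : ℝ) {M J K : ℤ} (h : J < 0 ∨ K < 0 ∨ M < J + K) :
    Q3ext M J K x y z = 0 :=
  if_neg (by omega)

/-- Contribution of `C_j^{k+2}` to the terms raising `k`. -/
theorem up_same {x y : ℝ} (hxy : 0 < 1 - x ^ 2 - y ^ 2) (z : ℝ) (m j k : ℕ) :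
    ((k : ℝ) + 1) ^ 2 / ((2 * k + 1) * (j + k + 1)) *
      (gegenbauer ((j : ℝ) + k + 3 / 2) m x * ballTail x y z j (k + 1)) / √(normSq3 m j k) =
    e3 j k (m + j + k) * Q3ext (m + j + k + 1) j (k + 1) x y z +
      e1 j (k + 1) (m + j + k - 1) * Q3ext (m + j + k - 1) j (k + 1) x y z := by
  have hpos : (0 : ℝ) < j + k + 3 / 2 := by positivity
  rw [Q3ext_eq hxy z (m := m) (j := j) (k := k + 1) (by push_cast; ring) rfl (by push_cast; ring)]
  have h3 := e3_div_sqrt_normSq3_up m j k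
  push_cast
  rw [show (j : ℝ) + (k + 1) + 3 / 2 = j + k + 3 / 2 + 1 by ring]
  rcases lt_or_ge m 2 with hm | hm
  · rw [Q3ext_eq_zero x y z (by omega), gegenbauer_raise_of_lt_two hpos x hm]
    linear_combination
      -(gegenbauer ((j : ℝ) + k + 3 / 2 + 1) m x * ballTail x y z j (k + 1)) * h3
  · obtain ⟨m, rfl⟩ := Nat.exists_eq_add_of_le' hm
    rw [Q3ext_eq hxy z (m := m) (j := j) (k := k + 1) (by push_cast; ring) rfl (by push_cast; ring)]
    have h1 := e1_div_sqrt_normSq3_up m j k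
    push_cast at h3 ⊢
    rw [show (j : ℝ) + (k + 1) + 3 / 2 = j + k + 3 / 2 + 1 by ring, gegenbauer_raise hpos x m]
    linear_combination
      -(gegenbauer ((j : ℝ) + k + 3 / 2 + 1) (m + 2) x * ballTail x y z j (k + 1)) * h3
      - (gegenbauer ((j : ℝ) + k + 3 / 2 + 1) m x * ballTail x y z j (k + 1)) * h1

/-- Contribution of `C_{j-2}^{k+2}` to the terms raising `k`. -/
theorem up_shift {x y : ℝ} (hxy : 0 < 1 - x ^ 2 - y ^ 2) (z : ℝ) (m j k : ℕ) :
    -(((k : ℝ) + 1) ^ 2 / ((2 * k + 1) * (j + k + 3)) *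
      ((1 - x ^ 2) * gegenbauer ((j : ℝ) + k + 5 / 2 + 1) m x * ballTail x y z j (k + 1))) /
        √(normSq3 m (j + 2) k) =
    e4 (j + 2) k (m + (j + 2) + k) * Q3ext (m + (j + 2) + k + 1) j (k + 1) x y z +
      e2 j (k + 1) (m + (j + 2) + k - 1) * Q3ext (m + (j + 2) + k - 1) j (k + 1) x y z := by
  have hpos : (0 : ℝ) < j + k + 5 / 2 := by positivity
  rw [Q3ext_eq hxy z (m := m + 2) (j := j) (k := k + 1) (by push_cast; ring) rfl
      (by push_cast; ring),
    Q3ext_eq hxy z (m := m) (j := j) (k := k + 1) (by push_cast; ring) rfl (by push_cast; ring),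
    gegenbauer_lower hpos x m]
  have h4 := e4_div_sqrt_normSq3_up m j k
  have h2 := e2_div_sqrt_normSq3_up m j k
  push_cast
  rw [show (j : ℝ) + (k + 1) + 3 / 2 = j + k + 5 / 2 by ring]
  linear_combination
    -(gegenbauer ((j : ℝ) + k + 5 / 2) (m + 2) x * ballTail x y z j (k + 1)) * h4
    - (gegenbauer ((j : ℝ) + k + 5 / 2) m x * ballTail x y z j (k + 1)) * h2

/-- Contribution of `C_j^{k+1}` to the terms lowering `k + 1`. -/
theorem down_same {x y : ℝ} (hxy : 0 < 1 - x ^ 2 - y ^ 2) (z : ℝ) (m j k : ℕ) :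
    ((j : ℝ) + 2 * k + 2) * (j + 2 * k + 3) / (4 * (2 * k + 3) * (j + k + 2)) *
      ((1 - x ^ 2) * gegenbauer ((j : ℝ) + k + 3 / 2 + 1) m x * ballTail x y z j k) /
        √(normSq3 m j (k + 1)) =
    e1 j (k + 1) (m + j + (k + 1)) * Q3ext (m + j + (k + 1) + 1) j k x y z +
      e3 j k (m + j + (k + 1) - 1) * Q3ext (m + j + (k + 1) - 1) j k x y z := by
  have hpos : (0 : ℝ) < j + k + 3 / 2 := by positivity
  rw [Q3ext_eq hxy z (m := m + 2) (j := j) (k := k) (by push_cast; ring) rfl rfl,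
    Q3ext_eq hxy z (m := m) (j := j) (k := k) (by ring) rfl rfl,
    gegenbauer_lower hpos x m]
  have h1 := e1_div_sqrt_normSq3_down m j k
  have h3 := e3_div_sqrt_normSq3_down m j k
  linear_combination
    -(gegenbauer ((j : ℝ) + k + 3 / 2) (m + 2) x * ballTail x y z j k) * h1
    - (gegenbauer ((j : ℝ) + k + 3 / 2) m x * ballTail x y z j k) * h3

/-- Contribution of `C_{j+2}^{k+1}` to the terms lowering `k + 1`. -/
theorem down_shift {x y : ℝ} (hxy : 0 < 1 - x ^ 2 - y ^ 2) (z : ℝ) (m j k : ℕ) :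
    -(((j : ℝ) + 1) * (j + 2) / (4 * (2 * k + 3) * (j + k + 2)) *
      (gegenbauer ((j : ℝ) + k + 5 / 2) m x * ballTail x y z (j + 2) k)) /
        √(normSq3 m j (k + 1)) =
    e2 j (k + 1) (m + j + (k + 1)) * Q3ext (m + j + (k + 1) + 1) (j + 2) k x y z +
      e4 (j + 2) k (m + j + (k + 1) - 1) * Q3ext (m + j + (k + 1) - 1) (j + 2) k x y z := by
  have hpos : (0 : ℝ) < j + k + 5 / 2 := by positivity
  rw [Q3ext_eq hxy z (m := m) (j := j + 2) (k := k) (by push_cast; ring) (by push_cast; ring) rfl]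
  have h2 := e2_div_sqrt_normSq3_down m j k
  push_cast
  rw [show (j : ℝ) + 2 + k + 3 / 2 = j + k + 5 / 2 + 1 by ring]
  rcases lt_or_ge m 2 with hm | hm
  · rw [Q3ext_eq_zero x y z (by omega), gegenbauer_raise_of_lt_two hpos x hm]
    linear_combination
      -(gegenbauer ((j : ℝ) + k + 5 / 2 + 1) m x * ballTail x y z (j + 2) k) * h2
  · obtain ⟨m, rfl⟩ := Nat.exists_eq_add_of_le' hm
    rw [Q3ext_eq hxy z (m := m) (j := j + 2) (k := k) (by push_cast; ring) (by push_cast; ring) rfl]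
    have h4 := e4_div_sqrt_normSq3_down m j k
    push_cast at h2 ⊢
    rw [show (j : ℝ) + 2 + k + 3 / 2 = j + k + 5 / 2 + 1 by ring, gegenbauer_raise hpos x m]
    linear_combination
      -(gegenbauer ((j : ℝ) + k + 5 / 2 + 1) (m + 2) x * ballTail x y z (j + 2) k) * h2
      - (gegenbauer ((j : ℝ) + k + 5 / 2 + 1) m x * ballTail x y z (j + 2) k) * h4

/-- The part of `z * ballTail x y z j k` whose Legendre factor has degree `k + 1`. -/
noncomputable def ballTailUp (x y z : ℝ) (j k : ℕ) : ℝ :=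
  ((k : ℝ) + 1) / (2 * k + 1) *
    (√(1 - x ^ 2) ^ j * gegenbauer ((k : ℝ) + 1) j (y / √(1 - x ^ 2)) *
    (√(1 - x ^ 2 - y ^ 2) ^ (k + 1) *
      gegenbauer (1 / 2) (k + 1) (z / √(1 - x ^ 2 - y ^ 2))))

theorem ballTailUp_of_lt_two (x y z : ℝ) {j : ℕ} (hj : j < 2) (k : ℕ) :
    ballTailUp x y z j k =
      ((k : ℝ) + 1) ^ 2 / ((2 * k + 1) * (j + k + 1)) * ballTail x y z j (k + 1) := by
  unfold ballTailUp ballTail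
  rw [gegenbauer_raise_of_lt_two (by positivity) _ hj]
  push_cast
  field_simp
  ring

theorem ballTailUp_add_two {x : ℝ} (hx : 0 < 1 - x ^ 2) (y z : ℝ) (j k : ℕ) :
    ballTailUp x y z (j + 2) k =
      ((k : ℝ) + 1) ^ 2 / ((2 * k + 1) * (j + k + 3)) *
        (ballTail x y z (j + 2) (k + 1) - (1 - x ^ 2) * ballTail x y z j (k + 1)) := by
  unfold ballTailUp ballTail
  rw [gegenbauer_raise (by positivity)]
  have hw := Real.sq_sqrt hx.le
  set v := √(1 - x ^ 2 - y ^ 2)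
  set w := √(1 - x ^ 2)
  rw [← hw]
  push_cast
  field_simp
  ring

theorem mul_ballTail_zero {x y : ℝ} (hxy : 0 < 1 - x ^ 2 - y ^ 2) (z : ℝ) (j : ℕ) :
    z * ballTail x y z j 0 = ballTailUp x y z j 0 := by
  have := Real.sqrt_pos.2 hxy
  unfold ballTailUp ballTail
  simp only [gegenbauer_zero, gegenbauer_one, zero_add, pow_zero, pow_one, Nat.cast_zero]
  field_simp
  ring

theorem mul_ballTail_succ {x y : ℝ} (hxy : 0 < 1 - x ^ 2 - y ^ 2) (z : ℝ) (j k : ℕ) :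
    z * ballTail x y z j (k + 1) = ballTailUp x y z j (k + 1) +
      (((j : ℝ) + 2 * k + 2) * (j + 2 * k + 3) / (4 * (2 * k + 3) * (j + k + 2)) *
        ((1 - x ^ 2) * ballTail x y z j k) -
      ((j : ℝ) + 1) * (j + 2) / (4 * (2 * k + 3) * (j + k + 2)) * ballTail x y z (j + 2) k) := by
  have hx : 0 < 1 - x ^ 2 := by nlinarith [sq_nonneg y]
  have hw := Real.sqrt_pos.2 hx
  have hv := Real.sqrt_pos.2 hxy
  have hw2 := Real.sq_sqrt hx.le
  have hv2 := Real.sq_sqrt hxy.le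
  unfold ballTailUp ballTail
  set w := √(1 - x ^ 2)
  set v := √(1 - x ^ 2 - y ^ 2)
  have hz : z = v * (z / v) := by field_simp
  have hy : v ^ 2 = w ^ 2 * (1 - (y / w) ^ 2) := by
    field_simp
    rw [hw2, hv2]
  have hG := gegenbauer_lower (lam := (k : ℝ) + 1) (by positivity) (y / w) j
  have hL := gegenbauer_half_mul k (z / v)
  rw [← hw2]
  nth_rw 1 [hz]
  push_cast
  generalize z / v = t at *
  generalize y / w = u at *
  have h_assoc : v * t * (w ^ j * gegenbauer ((k : ℝ) + 1 + 1) j u *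
      (v ^ (k + 1) * gegenbauer (1 / 2) (k + 1) t)) =
      w ^ j * gegenbauer ((k : ℝ) + 1 + 1) j u * v ^ (k + 2) *
        (t * gegenbauer (1 / 2) (k + 1) t) := by ring
  have h_weight : w ^ j * gegenbauer ((k : ℝ) + 1 + 1) j u * v ^ (k + 2) * gegenbauer (1 / 2) k t =
      w ^ (j + 2) * v ^ k * gegenbauer (1 / 2) k t *
        ((1 - u ^ 2) * gegenbauer ((k : ℝ) + 1 + 1) j u) := by
    rw [pow_add v, hy]
    ring
  rw [hG] at h_weight
  rw [h_assoc, hL]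
  have h_split : w ^ j * gegenbauer ((k : ℝ) + 1 + 1) j u * v ^ (k + 2) *
      (((k : ℝ) + 2) * gegenbauer (1 / 2) (k + 2) t + (k + 1) * gegenbauer (1 / 2) k t) /
        (2 * k + 3) =
      (k + 2) / (2 * k + 3) * (w ^ j * gegenbauer ((k : ℝ) + 1 + 1) j u * v ^ (k + 2) *
        gegenbauer (1 / 2) (k + 2) t) + (k + 1) / (2 * k + 3) *
      (w ^ j * gegenbauer ((k : ℝ) + 1 + 1) j u * v ^ (k + 2) * gegenbauer (1 / 2) k t) := by
    ring
  rw [mul_div_assoc] at h_split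
  rw [h_split, h_weight]
  have h1 : (j : ℝ) + (k + 1) + 1 ≠ 0 := by positivity
  field_simp
  ring

/-- The terms of the recursion raising `k`. -/
theorem ballTailUp_expansion {x y : ℝ} (hxy : 0 < 1 - x ^ 2 - y ^ 2) (z : ℝ) (m j k : ℕ) :
    gegenbauer ((j : ℝ) + k + 3 / 2) m x * ballTailUp x y z j k / √(normSq3 m j k) =
      e3 j k (m + j + k) * Q3ext (m + j + k + 1) j (k + 1) x y z +
      e4 j k (m + j + k) * Q3ext (m + j + k + 1) (j - 2) (k + 1) x y z +
      e2 (j - 2) (k + 1) (m + j + k - 1) * Q3ext (m + j + k - 1) (j - 2) (k + 1) x y z +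
      e1 j (k + 1) (m + j + k - 1) * Q3ext (m + j + k - 1) j (k + 1) x y z := by
  have hsame := up_same hxy z m j k
  rcases lt_or_ge j 2 with hj | hj
  · rw [Q3ext_eq_zero x y z (J := (j : ℤ) - 2) (by omega),
      Q3ext_eq_zero x y z (J := (j : ℤ) - 2) (by omega), ballTailUp_of_lt_two x y z hj]
    linear_combination hsame
  · obtain ⟨j, rfl⟩ := Nat.exists_eq_add_of_le' hj
    have hshift := up_shift hxy z m j k
    have hx : 0 < 1 - x ^ 2 := by nlinarith [sq_nonneg y]
    rw [ballTailUp_add_two hx]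
    push_cast at hsame ⊢
    rw [show (j : ℝ) + 2 + k + 3 / 2 = j + k + 5 / 2 + 1 by ring,
      show (j : ℝ) + 2 + k + 1 = j + k + 3 by ring] at hsame
    rw [show (j : ℝ) + 2 + k + 3 / 2 = j + k + 5 / 2 + 1 by ring, add_sub_cancel_right (j : ℤ) 2]
    linear_combination hsame + hshift

/-- the `z`-direction triple recursion relation for the `Q_n^{j,k}`. -/
theorem Q3_recursion_z (n j k : ℕ) (hjk : j + k ≤ n) (x y z : ℝ)
    (hxyz : (x, y, z) ∈ unitBall3) :
    z * Q3 n j k x y z =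
      e1 j k n * Q3ext ((n : ℤ) + 1) (j : ℤ) ((k : ℤ) - 1) x y z +
      e2 j k n * Q3ext ((n : ℤ) + 1) ((j : ℤ) + 2) ((k : ℤ) - 1) x y z +
      e3 j k n * Q3ext ((n : ℤ) + 1) (j : ℤ) ((k : ℤ) + 1) x y z +
      e4 j k n * Q3ext ((n : ℤ) + 1) ((j : ℤ) - 2) ((k : ℤ) + 1) x y z +
      e4 ((j : ℤ) + 2) ((k : ℤ) - 1) ((n : ℤ) - 1) *
        Q3ext ((n : ℤ) - 1) ((j : ℤ) + 2) ((k : ℤ) - 1) x y z +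
      e3 (j : ℤ) ((k : ℤ) - 1) ((n : ℤ) - 1) *
        Q3ext ((n : ℤ) - 1) (j : ℤ) ((k : ℤ) - 1) x y z +
      e2 ((j : ℤ) - 2) ((k : ℤ) + 1) ((n : ℤ) - 1) *
        Q3ext ((n : ℤ) - 1) ((j : ℤ) - 2) ((k : ℤ) + 1) x y z +
      e1 (j : ℤ) ((k : ℤ) + 1) ((n : ℤ) - 1) *
        Q3ext ((n : ℤ) - 1) (j : ℤ) ((k : ℤ) + 1) x y z := by
  have hxy : 0 < 1 - x ^ 2 - y ^ 2 := by
    have h : x ^ 2 + y ^ 2 + z ^ 2 < 1 := hxyz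
    nlinarith [sq_nonneg z]
  obtain ⟨m, rfl⟩ : ∃ m, n = m + j + k := ⟨n - j - k, by omega⟩
  have hup := ballTailUp_expansion hxy z m j k
  rw [Q3_eq hxy]
  push_cast
  cases k with
  | zero =>
    have hz := mul_ballTail_zero hxy z j
    push_cast at hup ⊢
    simp only [Q3ext_eq_zero x y z (K := -1) (Or.inr (Or.inl neg_one_lt_zero)), mul_zero]
    linear_combination
      (gegenbauer ((j : ℝ) + 0 + 3 / 2) m x / √(normSq3 m j 0)) * hz + hup
  | succ k =>
    have hz := mul_ballTail_succ hxy z j k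
    have hsame := down_same hxy z m j k
    have hshift := down_shift hxy z m j k
    push_cast at hup ⊢
    rw [add_sub_cancel_right (k : ℤ) 1]
    rw [show (j : ℝ) + (k + 1) + 3 / 2 = j + k + 5 / 2 by ring] at hup ⊢
    rw [show (j : ℝ) + k + 3 / 2 + 1 = j + k + 5 / 2 by ring] at hsame
    linear_combination
      (gegenbauer ((j : ℝ) + k + 5 / 2) m x / √(normSq3 m j (k + 1))) * hz +
        hup + hsame + hshift
end

section
/- Let q ≥ 1 and n ≥ 0 be integers with q ≥ n+1. Suppose ζ_1,…,ζ_q ∈ [−1,1] and ν_1,…,ν_q ∈ ℝ satisfy ∫_0^1 r²·v(r) dr = Σ_{k=1}^{q} ν_k·v((ζ_k+1)/2) for every univariate polynomial v of degree at most 2q−1, and suppose ξ_1,…,ξ_q ∈ [−1,1] and ω_1,…,ω_q ∈ ℝ satisfy ∫_{−1}^{1} w(t) dt = Σ_{j=1}^{q} ω_j·w(ξ_j) for every univariate polynomial w of degree at most 2q−1. Then for every polynomial g ∈ ℝ[x,y,z] of total degree at most 2n: ∫_{B₃} g(x,y,z) dx dy dz = Σ_{i=1}^{2q} Σ_{j=1}^{q}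 Σ_{k=1}^{q} (π/q)·ω_j·ν_k·g̃((ζ_k+1)/2, πi/q, arccos ξ_j), where g̃(r,θ,φ) = g(r·sin φ·cos θ, r·sin φ·sin θ, r·cos φ) is the spherical-coordinate representation of g. -/
open MeasureTheory Real Filter

/-- The `2q`-point trapezoidal rule is exact for exponentials of frequency below `2q`. -/
theorem trapezoid_exp_exact {q : ℕ} (hq : 0 < q) (m : ℤ) (hm : |m| < 2 * q) :
    (∫ θ in (-π)..π, Complex.exp (m * θ * Complex.I)) =
      (π / q : ℂ) * ∑ i ∈ Finset.Icc 1 (2 * q), Complex.exp (m * (π * i / q) * Complex.I) := by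
  have hqC : (q : ℂ) ≠ 0 := by exact_mod_cast hq.ne'
  have hπ : (π : ℂ) ≠ 0 := by exact_mod_cast Real.pi_ne_zero
  rcases eq_or_ne m 0 with rfl | h0
  · simp
    field_simp
    ring
  have hmC : (m : ℂ) ≠ 0 := by exact_mod_cast h0
  have hint : (∫ θ in (-π)..π, Complex.exp (m * θ * Complex.I)) = 0 := by
    have hc : (m * Complex.I : ℂ) ≠ 0 := mul_ne_zero hmC Complex.I_ne_zero
    have := integral_exp_mul_complex (a := -π) (b := π) hc
    simp_rw [mul_right_comm (m : ℂ) _ Complex.I]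
    rw [this, div_eq_zero_iff]
    left
    rw [sub_eq_zero, Complex.exp_eq_exp_iff_exists_int]
    exact ⟨m, by push_cast; ring⟩
  rw [hint]
  set ζ : ℂ := Complex.exp (m * (π / q) * Complex.I) with hζdef
  have hpow (i : ℕ) : Complex.exp (m * (π * i / q) * Complex.I) = ζ ^ i := by
    rw [hζdef, ← Complex.exp_nat_mul]
    congr 1
    ring
  have hne : ζ ≠ 1 := by
    intro h
    obtain ⟨k, hk⟩ := Complex.exp_eq_one_iff.1 h
    have hI := Complex.I_ne_zero
    have h1 : (m : ℂ) = k * (2 * q) := by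
      field_simp at hk
      linear_combination hk
    have h2 : m = k * (2 * q) := by exact_mod_cast h1
    have := Int.eq_zero_of_abs_lt_dvd (m := 2 * q) ⟨k, by rw [h2]; ring⟩ hm
    exact h0 this
  have hone : ζ ^ (2 * q) = 1 := by
    rw [hζdef, ← Complex.exp_nat_mul, Complex.exp_eq_one_iff]
    refine ⟨m, ?_⟩
    push_cast
    field_simp
  have hsum : ∑ i ∈ Finset.Icc 1 (2 * q), ζ ^ i = 0 := by
    rw [← Finset.Ico_add_one_right_eq_Icc, geom_sum_Ico hne (by omega), pow_succ, hone]
    simp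
  simp_rw [hpow, hsum, mul_zero]

/-- A monomial in `cos` and `sin` as a combination of complex exponentials. -/
theorem exists_cos_pow_mul_sin_pow_eq_sum (a b : ℕ) : ∃ c : ℕ → ℂ, ∀ θ : ℝ,
    ((cos θ ^ a * sin θ ^ b : ℝ) : ℂ) = ∑ k ∈ Finset.range (2 * (a + b) + 1),
      c k * Complex.exp (((k : ℤ) - (a + b : ℕ) : ℤ) * θ * Complex.I) := by
  let P : Polynomial ℂ := (Polynomial.C (1 / 2) * (Polynomial.X ^ 2 + 1)) ^ a *
    (Polynomial.C (-Complex.I / 2) * (Polynomial.X ^ 2 - 1)) ^ b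
  have hP : P.natDegree < 2 * (a + b) + 1 := by
    have : P.natDegree ≤ a * 2 + b * 2 := by
      dsimp only [P]
      refine Polynomial.natDegree_mul_le_of_le
        (Polynomial.natDegree_pow_le_of_le a ?_) (Polynomial.natDegree_pow_le_of_le b ?_) <;>
      compute_degree
    omega
  refine ⟨P.coeff, fun θ => ?_⟩
  have hexp (k : ℕ) : Complex.exp (((k : ℤ) - (a + b : ℕ) : ℤ) * θ * Complex.I) =
      Complex.exp (-(θ * Complex.I)) ^ (a + b) * Complex.exp (θ * Complex.I) ^ k := by
    rw [← Complex.exp_nat_mul, ← Complex.exp_nat_mul, ← Complex.exp_add]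
    congr 1
    push_cast
    ring
  have hinv : Complex.exp (-(θ * Complex.I)) * Complex.exp (θ * Complex.I) = 1 := by
    rw [← Complex.exp_add]
    simp
  simp_rw [hexp, mul_left_comm (P.coeff _), ← Finset.mul_sum]
  rw [← Polynomial.eval_eq_sum_range' hP]
  simp only [P, Polynomial.eval_mul, Polynomial.eval_pow, Polynomial.eval_C, Polynomial.eval_add,
    Polynomial.eval_sub, Polynomial.eval_X, Polynomial.eval_one]
  push_cast
  rw [pow_add, mul_mul_mul_comm, ← mul_pow, ← mul_pow, Complex.cos, Complex.sin, neg_mul]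
  congr 2
  · linear_combination (-Complex.exp (θ * Complex.I) / 2) * hinv
  · linear_combination (Complex.I * Complex.exp (θ * Complex.I) / 2) * hinv

theorem trapezoid_cos_pow_mul_sin_pow_exact {q : ℕ} (a b : ℕ) (hab : a + b < 2 * q) :
    (∫ θ in (-π)..π, cos θ ^ a * sin θ ^ b) =
      (π / q) * ∑ i ∈ Finset.Icc 1 (2 * q), cos (π * i / q) ^ a * sin (π * i / q) ^ b := by
  obtain ⟨c, hc⟩ := exists_cos_pow_mul_sin_pow_eq_sum a b
  apply Complex.ofReal_injective
  rw [← intervalIntegral.integral_ofReal]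
  simp_rw [hc]
  rw [intervalIntegral.integral_finsetSum
    fun k _ => (by fun_prop : Continuous _).intervalIntegrable _ _]
  rw [Complex.ofReal_mul, Complex.ofReal_sum]
  simp_rw [hc]
  rw [Finset.sum_comm, Finset.mul_sum]
  refine Finset.sum_congr rfl fun k hk => ?_
  have hk' := Finset.mem_range.1 hk
  rw [intervalIntegral.integral_const_mul, trapezoid_exp_exact (q := q) (by omega) _
    (by rw [abs_lt]; constructor <;> push_cast <;> omega), ← Finset.mul_sum]
  push_cast
  ring

theorem integral_cos_pow_mul_sin_pow_eq_zero_of_odd {a b : ℕ} (hab : Odd (a + b)) :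
    (∫ θ in (-π)..π, cos θ ^ a * sin θ ^ b) = 0 := by
  have hper : Function.Periodic (fun θ : ℝ => cos θ ^ a * sin θ ^ b) (2 * π) := fun θ => by
    simp
  have h1 := hper.intervalIntegral_add_eq (-π) 0
  have h2 := intervalIntegral.integral_comp_add_right
    (a := -π) (b := π) (fun θ : ℝ => cos θ ^ a * sin θ ^ b) π
  have h3 : ∀ θ : ℝ, cos (θ + π) ^ a * sin (θ + π) ^ b = -(cos θ ^ a * sin θ ^ b) := fun θ => by
    rw [cos_add_pi, sin_add_pi, neg_pow, neg_pow (sin θ), mul_mul_mul_comm, ← pow_add,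
      hab.neg_one_pow]
    ring
  simp_rw [h3] at h2
  rw [intervalIntegral.integral_neg, neg_add_cancel, ← two_mul] at h2
  rw [show -π + 2 * π = π by ring, zero_add] at h1
  linarith

theorem integral_disc_monomial (a b : ℕ) (d : ℝ) :
    (∫ w in {w : ℝ × ℝ | w.1 ^ 2 + w.2 ^ 2 < d}, w.1 ^ a * w.2 ^ b) =
      √d ^ (a + b + 2) / (a + b + 2) * ∫ θ in (-π)..π, cos θ ^ a * sin θ ^ b := by
  have hmeas : MeasurableSet {w : ℝ × ℝ | w.1 ^ 2 + w.2 ^ 2 < d} :=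
    (isOpen_lt (by fun_prop) (by fun_prop)).measurableSet
  have hrad : (∫ r in Set.Ioi (0 : ℝ), (Set.Iio √d).indicator (fun r => r ^ (a + b + 1)) r) =
      √d ^ (a + b + 2) / (a + b + 2) := by
    rw [setIntegral_indicator measurableSet_Iio, Set.Ioi_inter_Iio, ← integral_Ioc_eq_integral_Ioo,
      ← intervalIntegral.integral_of_le (sqrt_nonneg d), integral_pow]
    push_cast
    ring
  rw [← integral_indicator hmeas, ← integral_comp_polarCoord_symm,
    intervalIntegral.integral_of_le (by linarith [pi_pos]), integral_Ioc_eq_integral_Ioo, ← hrad,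
    ← setIntegral_prod_mul]
  refine setIntegral_congr_fun (measurableSet_Ioi.prod measurableSet_Ioo) fun p hp => ?_
  have hp0 : 0 < p.1 := hp.1
  have hiff : (p.1 * cos p.2) ^ 2 + (p.1 * sin p.2) ^ 2 < d ↔ p.1 < √d := by
    rw [Real.lt_sqrt hp0.le, mul_pow, mul_pow, ← mul_add, cos_sq_add_sin_sq, mul_one]
  simp only [polarCoord_symm_apply, Set.indicator_apply, Set.mem_ofPred_eq, hiff, Set.mem_Iio,
    smul_eq_mul]
  split_ifs
  · ring
  · simp

theorem integral_pow_mul_one_sub_sq_pow_succ (s c : ℕ) :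
    (2 * s + c + 3 : ℝ) * ∫ t in (-1 : ℝ)..1, t ^ c * (1 - t ^ 2) ^ (s + 1) =
      (2 * s + 2) * ∫ t in (-1 : ℝ)..1, t ^ c * (1 - t ^ 2) ^ s := by
  have hderiv (t : ℝ) : HasDerivAt (fun t : ℝ => t ^ (c + 1) * (1 - t ^ 2) ^ (s + 1))
      ((2 * s + c + 3 : ℝ) * (t ^ c * (1 - t ^ 2) ^ (s + 1)) -
        (2 * s + 2) * (t ^ c * (1 - t ^ 2) ^ s)) t := by
    refine ((hasDerivAt_pow (c + 1) t).fun_mul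
      (((hasDerivAt_pow 2 t).const_sub 1).fun_pow (s + 1))).congr_deriv ?_
    push_cast
    ring
  have h := intervalIntegral.integral_eq_sub_of_hasDerivAt (a := -1) (b := 1)
    (fun t _ => hderiv t) ((by fun_prop : Continuous _).intervalIntegrable _ _)
  rw [intervalIntegral.integral_sub ((by fun_prop : Continuous _).intervalIntegrable _ _)
    ((by fun_prop : Continuous _).intervalIntegrable _ _),
    intervalIntegral.integral_const_mul, intervalIntegral.integral_const_mul] at h
  norm_num at h
  linarith

theorem measurableSet_unitBall3 : MeasurableSet unitBall3 :=
  (isOpen_lt (by fun_prop) (by fun_prop)).measurableSet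

theorem Continuous.integrableOn_unitBall3 {f : ℝ × ℝ × ℝ → ℝ} (hf : Continuous f) :
    IntegrableOn f unitBall3 := by
  refine (hf.continuousOn.integrableOn_compact
    (isCompact_Icc (a := ((-1, -1, -1) : ℝ × ℝ × ℝ)) (b := (1, 1, 1)))).mono_set ?_
  rintro ⟨x, y, z⟩ h
  have h' : x ^ 2 + y ^ 2 + z ^ 2 < 1 := h
  simp only [Set.mem_Icc, Prod.mk_le_mk]
  refine ⟨⟨?_, ?_, ?_⟩, ?_, ?_, ?_⟩ <;> nlinarith [sq_nonneg x, sq_nonneg y, sq_nonneg z]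

theorem integral_unitBall3_monomial_eq_integral_slices (a b c : ℕ) :
    (∫ p in unitBall3, p.1 ^ a * p.2.1 ^ b * p.2.2 ^ c) =
      ∫ z : ℝ, z ^ c * (√(1 - z ^ 2) ^ (a + b + 2) / (a + b + 2) *
        ∫ θ in (-π)..π, cos θ ^ a * sin θ ^ b) := by
  have hint : Integrable (unitBall3.indicator fun p => p.1 ^ a * p.2.1 ^ b * p.2.2 ^ c) :=
    (Continuous.integrableOn_unitBall3 (by fun_prop)).integrable_indicator measurableSet_unitBall3
  have hmp := volume_preserving_prodAssoc (α₁ := ℝ) (β₁ := ℝ) (γ₁ := ℝ)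
  rw [← integral_indicator measurableSet_unitBall3,
    ← hmp.integral_comp MeasurableEquiv.prodAssoc.measurableEmbedding, Measure.volume_eq_prod,
    integral_prod_symm (fun p => unitBall3.indicator _ (MeasurableEquiv.prodAssoc p))
      ((hmp.integrable_comp_emb MeasurableEquiv.prodAssoc.measurableEmbedding).2 hint)]
  congr 1 with z
  rw [← integral_disc_monomial, ← integral_indicator
    (isOpen_lt (by fun_prop) (by fun_prop)).measurableSet, ← integral_const_mul]
  congr 1 with w
  have hiff : (w.1, w.2, z) ∈ unitBall3 ↔ w.1 ^ 2 + w.2 ^ 2 < 1 - z ^ 2 := by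
    change w.1 ^ 2 + w.2 ^ 2 + z ^ 2 < 1 ↔ _
    exact lt_sub_iff_add_lt.symm
  change unitBall3.indicator _ (w.1, w.2, z) = _
  simp only [Set.indicator, hiff, Set.mem_ofPred_eq]
  split_ifs
  · ring
  · simp

theorem integral_unitBall3_monomial_of_even {a b s : ℕ} (c : ℕ) (hs : a + b = 2 * s) :
    (∫ p in unitBall3, p.1 ^ a * p.2.1 ^ b * p.2.2 ^ c) =
      (∫ θ in (-π)..π, cos θ ^ a * sin θ ^ b) *
        ((∫ t in (-1 : ℝ)..1, t ^ c * (1 - t ^ 2) ^ s) * (1 / (a + b + c + 3))) := by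
  have hs' : (a + b : ℝ) = 2 * s := by exact_mod_cast hs
  have hz : (∫ z : ℝ, z ^ c * √(1 - z ^ 2) ^ (a + b + 2)) =
      ∫ t in (-1 : ℝ)..1, t ^ c * (1 - t ^ 2) ^ (s + 1) := by
    rw [intervalIntegral.integral_of_le (by norm_num),
      ← setIntegral_eq_integral_of_forall_compl_eq_zero
      (s := Set.Ioc (-1 : ℝ) 1)]
    · refine setIntegral_congr_fun measurableSet_Ioc fun z hz => ?_
      have h : 0 ≤ 1 - z ^ 2 := by nlinarith [hz.1, hz.2]
      rw [hs, show 2 * s + 2 = 2 * (s + 1) by ring, pow_mul, sq_sqrt h]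
    · intro z hz
      have h : 1 - z ^ 2 ≤ 0 := by
        rw [Set.mem_Ioc, not_and_or, not_lt, not_le] at hz
        rcases hz with hz | hz <;> nlinarith
      rw [sqrt_eq_zero_of_nonpos h]
      simp
  rw [integral_unitBall3_monomial_eq_integral_slices]
  simp_rw [← mul_assoc, mul_div_assoc', integral_mul_const, integral_div, hz, hs']
  have h := integral_pow_mul_one_sub_sq_pow_succ s c
  have h1 : (2 * s + 2 : ℝ) ≠ 0 := by positivity
  have h2 : (2 * s + c + 3 : ℝ) ≠ 0 := by positivity
  field_simp
  linear_combination (∫ θ in (-π)..π, cos θ ^ a * sin θ ^ b) * h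

theorem ball_quadrature_exact_monomial {q : ℕ} (ζ ν ξ ω : ℕ → ℝ)
    (hξ : ∀ j ∈ Finset.Icc 1 q, ξ j ∈ Set.Icc (-1 : ℝ) 1)
    (hrad : ∀ v : Polynomial ℝ, v.natDegree ≤ 2 * q - 1 →
      (∫ r in (0 : ℝ)..1, r ^ 2 * v.eval r) =
        ∑ k ∈ Finset.Icc 1 q, ν k * v.eval ((ζ k + 1) / 2))
    (hleg : ∀ w : Polynomial ℝ, w.natDegree ≤ 2 * q - 1 →
      (∫ t in (-1 : ℝ)..1, w.eval t) =
        ∑ j ∈ Finset.Icc 1 q, ω j * w.eval (ξ j))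
    (a b c : ℕ) (habc : a + b + c < 2 * q) :
    (∫ p in unitBall3, p.1 ^ a * p.2.1 ^ b * p.2.2 ^ c) =
      ∑ i ∈ Finset.Icc 1 (2 * q), ∑ j ∈ Finset.Icc 1 q, ∑ k ∈ Finset.Icc 1 q,
        (π / q) * ω j * ν k *
          ((((ζ k + 1) / 2) * sin (arccos (ξ j)) * cos (π * i / q)) ^ a *
            (((ζ k + 1) / 2) * sin (arccos (ξ j)) * sin (π * i / q)) ^ b *
            (((ζ k + 1) / 2) * cos (arccos (ξ j))) ^ c) := by
  have hfactor : (∑ i ∈ Finset.Icc 1 (2 * q), ∑ j ∈ Finset.Icc 1 q, ∑ k ∈ Finset.Icc 1 q,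
        (π / q) * ω j * ν k *
          ((((ζ k + 1) / 2) * sin (arccos (ξ j)) * cos (π * i / q)) ^ a *
            (((ζ k + 1) / 2) * sin (arccos (ξ j)) * sin (π * i / q)) ^ b *
            (((ζ k + 1) / 2) * cos (arccos (ξ j))) ^ c)) =
      ((π / q) * ∑ i ∈ Finset.Icc 1 (2 * q), cos (π * i / q) ^ a * sin (π * i / q) ^ b) *
        ((∑ j ∈ Finset.Icc 1 q,
            ω j * (cos (arccos (ξ j)) ^ c * sin (arccos (ξ j)) ^ (a + b))) *
          ∑ k ∈ Finset.Icc 1 q, ν k * ((ζ k + 1) / 2) ^ (a + b + c)) := by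
    rw [Finset.mul_sum, Finset.sum_mul_sum, Finset.sum_mul]
    simp_rw [Finset.mul_sum]
    refine Finset.sum_congr rfl fun i _ => Finset.sum_congr rfl fun j _ =>
      Finset.sum_congr rfl fun k _ => ?_
    simp only [mul_pow, pow_add]
    ring
  rw [hfactor, ← trapezoid_cos_pow_mul_sin_pow_exact a b (by omega)]
  rcases Nat.even_or_odd' (a + b) with ⟨s, hs | hs⟩
  · have hr := hrad (Polynomial.X ^ (a + b + c)) (by rw [Polynomial.natDegree_X_pow]; omega)
    have hl := hleg (Polynomial.X ^ c * (1 - Polynomial.X ^ 2) ^ s) (by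
      refine (Polynomial.natDegree_mul_le_of_le (Polynomial.natDegree_X_pow_le c)
        (Polynomial.natDegree_pow_le_of_le (n := s) (m := 2)
          (by compute_degree))).trans (by omega))
    simp only [Polynomial.eval_mul, Polynomial.eval_pow, Polynomial.eval_X, Polynomial.eval_sub,
      Polynomial.eval_one, ← pow_add] at hr hl
    rw [integral_unitBall3_monomial_of_even c hs, hl, ← hr, integral_pow]
    congr 2
    · refine Finset.sum_congr rfl fun j hj => ?_
      have hj' := hξ j hj
      rw [hs, pow_mul, sin_sq, cos_arccos hj'.1 hj'.2]
    · push_cast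
      norm_num
      ring
  · rw [integral_unitBall3_monomial_eq_integral_slices,
      integral_cos_pow_mul_sin_pow_eq_zero_of_odd ⟨s, hs⟩]
    simp

/-- the quadrature rule on the unit ball built from the
trapezoidal rule in the azimuthal angle, a Gauss rule for the radial weight
`r²`, and Gauss–Legendre in the polar angle, is exact for all trivariate
polynomials of total degree at most `2n`, provided `q ≥ n + 1`. -/
theorem ball_quadrature_exact (q n : ℕ) (hq : n + 1 ≤ q)
    (ζ ν ξ ω : ℕ → ℝ)
    (hζ : ∀ k ∈ Finset.Icc 1 q, ζ k ∈ Set.Icc (-1 : ℝ) 1)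
    (hξ : ∀ j ∈ Finset.Icc 1 q, ξ j ∈ Set.Icc (-1 : ℝ) 1)
    (hrad : ∀ v : Polynomial ℝ, v.natDegree ≤ 2 * q - 1 →
      (∫ r in (0 : ℝ)..1, r ^ 2 * v.eval r) =
        ∑ k ∈ Finset.Icc 1 q, ν k * v.eval ((ζ k + 1) / 2))
    (hleg : ∀ w : Polynomial ℝ, w.natDegree ≤ 2 * q - 1 →
      (∫ t in (-1 : ℝ)..1, w.eval t) =
        ∑ j ∈ Finset.Icc 1 q, ω j * w.eval (ξ j))
    (g : MvPolynomial (Fin 3) ℝ) (hg : g.totalDegree ≤ 2 * n) :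
    (∫ p in unitBall3, MvPolynomial.eval ![p.1, p.2.1, p.2.2] g) =
      ∑ i ∈ Finset.Icc 1 (2 * q), ∑ j ∈ Finset.Icc 1 q, ∑ k ∈ Finset.Icc 1 q,
        (π / q) * ω j * ν k *
          MvPolynomial.eval
            ![((ζ k + 1) / 2) * Real.sin (Real.arccos (ξ j)) * Real.cos (π * i / q),
              ((ζ k + 1) / 2) * Real.sin (Real.arccos (ξ j)) * Real.sin (π * i / q),
              ((ζ k + 1) / 2) * Real.cos (Real.arccos (ξ j))] g := by
  have hint (d : Fin 3 →₀ ℕ) : IntegrableOn (fun p : ℝ × ℝ × ℝ =>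
      g.coeff d * (p.1 ^ d 0 * p.2.1 ^ d 1 * p.2.2 ^ d 2)) unitBall3 :=
    Continuous.integrableOn_unitBall3 (by fun_prop)
  simp only [MvPolynomial.eval_eq', Fin.prod_univ_three, Matrix.cons_val_zero,
    Matrix.cons_val_one, Matrix.cons_val]
  rw [integral_finsetSum _ fun d _ => hint d]
  simp_rw [integral_const_mul, Finset.mul_sum]
  have hswap (F : ℕ → ℕ → ℕ → (Fin 3 →₀ ℕ) → ℝ) :
      (∑ i ∈ Finset.Icc 1 (2 * q), ∑ j ∈ Finset.Icc 1 q, ∑ k ∈ Finset.Icc 1 q,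
        ∑ d ∈ g.support, F i j k d) =
      ∑ d ∈ g.support, ∑ i ∈ Finset.Icc 1 (2 * q), ∑ j ∈ Finset.Icc 1 q, ∑ k ∈ Finset.Icc 1 q,
        F i j k d := by
    simp_rw [Finset.sum_comm (t := g.support)]
  rw [hswap]
  refine Finset.sum_congr rfl fun d hd => ?_
  have hdeg : d 0 + d 1 + d 2 < 2 * q := by
    have h := (MvPolynomial.le_totalDegree hd).trans hg
    rw [Finsupp.sum_fintype _ _ fun _ => rfl, Fin.sum_univ_three] at h
    omega
  rw [ball_quadrature_exact_monomial ζ ν ξ ω hξ hrad hleg (d 0) (d 1) (d 2) hdeg]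
  simp_rw [Finset.mul_sum]
  refine Finset.sum_congr rfl fun i _ => Finset.sum_congr rfl fun j _ =>
    Finset.sum_congr rfl fun k _ => ?_
  ring
end
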